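/- Let B be an even simple Bratteli diagram with full group G=G_B and path space X=X_B, and suppose the dynamical system (X,G) admits exactly k ergodic G-invariant Borel probability measures μ_1,…,μ_k, where 1≤k<∞. Then for every α=(α_1,…,α_k)∈Z_{≥0}^k, the stabilizer distribution φ_α of the diagonal action of G on (X^{|α|}, μ_α), where |α|=α_1+…+α_k and μ_α=μ_1^{α_1}×…×μ_k^{α_k}, is an ergodic invariant random subgroup of G (with X^0 a singleton carrying the trivial action, so φ_{(0,…,0)}=δ_{G}). -/

import Mathlib

open MeasureTheory Filter
open scoped ENNReal ComplexOrder

noncomputable section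

/-- A Bratteli diagram: vertex levels `V i`, edge levels `E i` (edges from `V i` to `V (i+1)`),
all levels finite and nonempty, a single root vertex, and source/range maps that are
surjective (every vertex emits and receives an edge). -/
structure BratteliDiagram where
  V : ℕ → Type
  E : ℕ → Type
  fintypeV : ∀ i, Fintype (V i)
  fintypeE : ∀ i, Fintype (E i)
  nonemptyV : ∀ i, Nonempty (V i)
  nonemptyE : ∀ i, Nonempty (E i)
  subsingleton_root : Subsingleton (V 0)
  src : ∀ i, E i → V i
  rng : ∀ i, E i → V (i + 1)
  src_surj : ∀ i, Function.Surjective (src i)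
  rng_surj : ∀ i, Function.Surjective (rng i)

namespace BratteliDiagram

variable (B : BratteliDiagram)

/-- The path space `X_B`: infinite paths starting at the root. -/
def Path : Type :=
  { x : ∀ i, B.E i // ∀ i, B.rng i (x i) = B.src (i + 1) (x (i + 1)) }

instance (i : ℕ) : UniformSpace (B.E i) := ⊥

instance instUniformSpacePath : UniformSpace B.Path :=
  inferInstanceAs (UniformSpace { x : ∀ i, B.E i // ∀ i, B.rng i (x i) = B.src (i + 1) (x (i + 1)) })

instance instMeasurableSpacePath : MeasurableSpace B.Path := borel _

/-- Finite segments of `L+1` consecutive edges starting at level `n`. -/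
def Seg (n L : ℕ) : Type :=
  { f : ∀ i : Fin (L + 1), B.E (n + (i : ℕ)) //
    ∀ (i : ℕ) (hi : i < L),
      B.rng (n + i) (f ⟨i, by omega⟩) = B.src (n + (i + 1)) (f ⟨i + 1, by omega⟩) }

/-- The number of finite paths connecting `v ∈ V n` to `w ∈ V (n + L + 1)`. -/
def numPaths (n L : ℕ) (v : B.V n) (w : B.V (n + L + 1)) : ℕ :=
  Nat.card { f : B.Seg n L //
    B.src n (f.1 ⟨0, by omega⟩) = v ∧ B.rng (n + L) (f.1 ⟨L, by omega⟩) = w }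

/-- A Bratteli diagram is simple if every vertex of a given level is connected
to every vertex of some deeper level. -/
def IsSimple : Prop :=
  ∀ n : ℕ, ∃ L : ℕ, ∀ (v : B.V n) (w : B.V (n + L + 1)), 0 < B.numPaths n L v w

/-- A Bratteli diagram is even if every vertex of a given level is connected to every
vertex of some deeper level by a (positive) even number of paths. -/
def IsEven : Prop :=
  ∀ n : ℕ, ∃ L : ℕ, ∀ (v : B.V n) (w : B.V (n + L + 1)),
    0 < B.numPaths n L v w ∧ Even (B.numPaths n L v w)

/-- A permutation of the path space "of level `n`": it changes only the first `n` edges,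
and what it does to the first `n` edges depends only on the first `n` edges. -/
def IsLevel (n : ℕ) (g : Equiv.Perm B.Path) : Prop :=
  (∀ (x : B.Path) (i : ℕ), n ≤ i → (g x).1 i = x.1 i) ∧
  (∀ x y : B.Path, (∀ i : ℕ, i < n → x.1 i = y.1 i) → ∀ i : ℕ, i < n → (g x).1 i = (g y).1 i)

theorem isLevel_one (n : ℕ) : B.IsLevel n 1 :=
  ⟨fun _ _ _ => rfl, fun _ _ h i hi => h i hi⟩

theorem IsLevel.mul {n : ℕ} {a b : Equiv.Perm B.Path} (ha : B.IsLevel n a)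
    (hb : B.IsLevel n b) : B.IsLevel n (a * b) := by
  constructor
  · intro x i hi
    have h1 := ha.1 (b x) i hi
    have h2 := hb.1 x i hi
    simpa [Equiv.Perm.mul_apply] using h1.trans h2
  · intro x y hxy i hi
    have h2 := hb.2 x y hxy
    have := ha.2 (b x) (b y) h2 i hi
    simpa [Equiv.Perm.mul_apply] using this

theorem IsLevel.mono {n m : ℕ} (hnm : n ≤ m) {g : Equiv.Perm B.Path}
    (h : B.IsLevel n g) : B.IsLevel m g := by
  refine ⟨fun x i hi => h.1 x i (hnm.trans hi), fun x y hxy i hi => ?_⟩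
  rcases lt_or_ge i n with h' | h'
  · exact h.2 x y (fun j hj => hxy j (hj.trans_le hnm)) i h'
  · rw [h.1 x i h', h.1 y i h']
    exact hxy i hi

/-- The group `G_n` of homeomorphisms of the path space permuting only the
first `n` edges of infinite paths. -/
def level (n : ℕ) : Subgroup (Equiv.Perm B.Path) where
  carrier := { g | B.IsLevel n g ∧ B.IsLevel n g⁻¹ }
  one_mem' := ⟨B.isLevel_one n, by simpa using B.isLevel_one n⟩
  mul_mem' := by
    intro a b ha hb
    exact ⟨ha.1.mul B hb.1, by rw [mul_inv_rev]; exact IsLevel.mul B hb.2 ha.2⟩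
  inv_mem' := by
    intro a ha
    exact ⟨ha.2, by simpa using ha.1⟩

theorem level_mono {n m : ℕ} (h : n ≤ m) : B.level n ≤ B.level m := by
  intro g hg
  exact ⟨hg.1.mono B h, hg.2.mono B h⟩

/-- The full group `G_B = ⋃ n, G_n` of the Bratteli diagram. -/
def fullGroup : Subgroup (Equiv.Perm B.Path) where
  carrier := { g | ∃ n, g ∈ B.level n }
  one_mem' := ⟨0, one_mem _⟩
  mul_mem' := by
    rintro a b ⟨n, ha⟩ ⟨m, hb⟩
    exact ⟨max n m, mul_mem (B.level_mono (le_max_left n m) ha)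
      (B.level_mono (le_max_right n m) hb)⟩
  inv_mem' := by
    rintro a ⟨n, ha⟩
    exact ⟨n, inv_mem ha⟩

/-- `G_n` viewed as a subgroup of the full group. -/
def levelIn (n : ℕ) : Subgroup ↥B.fullGroup := (B.level n).comap B.fullGroup.subtype

/-- The subgroup `G°(A)` of elements of the full group fixing `A` pointwise. -/
def Gcirc (A : Set B.Path) : Subgroup ↥B.fullGroup :=
  ⨅ x ∈ A, MulAction.stabilizer ↥B.fullGroup x

/-- `G°_n(A) = G_n ∩ G°(A)`. -/
def GcircN (n : ℕ) (A : Set B.Path) : Subgroup ↥B.fullGroup :=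
  B.levelIn n ⊓ B.Gcirc A

end BratteliDiagram

/-- Conjugation of a subgroup: `g • H = gHg⁻¹`. -/
def conjSub {Γ : Type*} [Group Γ] (g : Γ) (H : Subgroup Γ) : Subgroup Γ :=
  Subgroup.map (MulAut.conj g).toMonoidHom H

/-- The Borel structure on the space `Sub(Γ)` of subgroups of `Γ`,
induced from the product space `{0,1}^Γ` (equivalently `Set Γ`). -/
instance subgroupMeasurableSpace {Γ : Type*} [Group Γ] : MeasurableSpace (Subgroup Γ) :=
  MeasurableSpace.comap (fun H => (H : Set Γ)) inferInstance

namespace BratteliDiagram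

variable (B : BratteliDiagram)

/-- `F(A)`: the collection of subgroups of the full group normalized by `G°(A)`. -/
def FF (A : Set B.Path) : Set (Subgroup ↥B.fullGroup) :=
  { H | ∀ g ∈ B.Gcirc A, conjSub g H = H }

end BratteliDiagram

/-- A measure `ν` on `Y` is invariant under the action of `G`. -/
def MeasInv (G : Type*) [Group G] {Y : Type*} [MeasurableSpace Y] [MulAction G Y]
    (ν : Measure Y) : Prop :=
  ∀ (g : G) (s : Set Y), MeasurableSet s → ν ((fun y => g • y) ⁻¹' s) = ν s

/-- The action of `G` on `(Y, ν)` is ergodic: every invariant measurable set is null or conull. -/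
def MeasErg (G : Type*) [Group G] {Y : Type*} [MeasurableSpace Y] [MulAction G Y]
    (ν : Measure Y) : Prop :=
  ∀ s : Set Y, MeasurableSet s → (∀ g : G, (fun y => g • y) ⁻¹' s = s) → ν s = 0 ∨ ν s = 1

/-- An invariant random subgroup: a conjugation-invariant Borel probability measure on `Sub(G)`. -/
def IsIRS (G : Type*) [Group G] (φ : Measure (Subgroup G)) : Prop :=
  IsProbabilityMeasure φ ∧
    ∀ (g : G) (s : Set (Subgroup G)), MeasurableSet s → φ (conjSub g ⁻¹' s) = φ s

/-- An ergodic invariant random subgroup. -/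
def IsErgodicIRS (G : Type*) [Group G] (φ : Measure (Subgroup G)) : Prop :=
  IsIRS G φ ∧
    ∀ s : Set (Subgroup G), MeasurableSet s → (∀ g : G, conjSub g ⁻¹' s = s) →
      φ s = 0 ∨ φ s = 1

/-- A character of a group: normalized, central, positive semidefinite complex function. -/
def IsCharacter (G : Type*) [Group G] (χ : G → ℂ) : Prop :=
  χ 1 = 1 ∧ (∀ a b : G, χ (a * b) = χ (b * a)) ∧
    ∀ (n : ℕ) (g : Fin n → G) (c : Fin n → ℂ),
      0 ≤ ∑ i, ∑ j, (starRingEnd ℂ) (c i) * c j * χ (g i * (g j)⁻¹)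

namespace BratteliDiagram

variable (B : BratteliDiagram)

/-- The product measure `μ_α = μ_1^{α_1} × ⋯ × μ_k^{α_k}` on `X^{|α|}`,
realized on the index type `Σ i : Fin k, Fin (α i)` (of cardinality `|α| = Σ α i`). -/
def prodMeasure {k : ℕ} (μ : Fin k → Measure B.Path) (α : Fin k → ℕ) :
    Measure ((Σ i : Fin k, Fin (α i)) → B.Path) :=
  Measure.pi fun p => μ p.1

/-- The stabilizer distribution `φ_α` of the diagonal action of the full group
on `(X^{|α|}, μ_α)`. -/
def stabDist {k : ℕ} (μ : Fin k → Measure B.Path) (α : Fin k → ℕ) :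
    Measure (Subgroup ↥B.fullGroup) :=
  Measure.map (fun y => MulAction.stabilizer ↥B.fullGroup y) (B.prodMeasure μ α)

end BratteliDiagram

namespace BratteliDiagram

section helpers

variable (B : BratteliDiagram)

instance instDiscE (i : ℕ) : DiscreteTopology (B.E i) := ⟨rfl⟩

instance instFiniteE (i : ℕ) : Finite (B.E i) := by
  have := B.fintypeE i
  exact inferInstance

instance instBorelPath : BorelSpace B.Path := ⟨rfl⟩

instance instT2Path : T2Space B.Path :=
  inferInstanceAs (T2Space { x : ∀ i, B.E i // ∀ i, B.rng i (x i) = B.src (i + 1) (x (i + 1)) })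

theorem continuous_coord (i : ℕ) : Continuous (fun x : B.Path => x.1 i) :=
  (continuous_apply i).comp continuous_subtype_val

/-- The first `n` edges. -/
def pre (n : ℕ) (x : B.Path) : ∀ i : Fin n, B.E i := fun i => x.1 i

theorem continuous_pre (n : ℕ) : Continuous (B.pre n) :=
  continuous_pi fun i => B.continuous_coord i

theorem continuous_of_isLevel {n : ℕ} {g : Equiv.Perm B.Path} (hg : B.IsLevel n g) :
    Continuous g := by
  refine Continuous.subtype_mk (f := fun x => (g x).1) (continuous_pi fun i => ?_) _
  rcases lt_or_ge i n with h | h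
  · have : (fun x => (g x).1 i) =
        (Function.extend (B.pre n) (fun x => (g x).1 i)
          (fun _ => (B.nonemptyE i).some)) ∘ B.pre n := by
      funext x
      simp only [Function.comp]
      have hf : Function.FactorsThrough (fun x => (g x).1 i) (B.pre n) := by
        intro x y hxy
        exact hg.2 x y (fun j hj => congrFun hxy ⟨j, hj⟩) i h
      exact (hf.extend_apply _ x).symm
    rw [this]
    exact continuous_of_discreteTopology.comp (B.continuous_pre n)
  · have : (fun x => (g x).1 i) = fun x => x.1 i := funext fun x => hg.1 x i h
    rw [this]
    exact B.continuous_coord i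

theorem measurable_smul (g : ↥B.fullGroup) : Measurable (fun x : B.Path => g • x) := by
  obtain ⟨n, hn⟩ := g.2
  exact (B.continuous_of_isLevel hn.1).measurable

instance finite_level (n : ℕ) : Finite ↥(B.level n) := by
  let F : ↥(B.level n) → (Set.range (B.pre n) → ∀ i : Fin n, B.E i) :=
    fun g e => B.pre n (g.1 e.2.choose)
  refine Finite.of_injective F ?_
  intro g g' h
  apply Subtype.ext
  ext x
  apply Subtype.ext
  funext i
  rcases lt_or_ge i n with hi | hi
  · have h1 := congrFun (congrFun h ⟨B.pre n x, x, rfl⟩) ⟨i, hi⟩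
    have h2 : B.pre n (Exists.choose (⟨x, rfl⟩ : ∃ y, B.pre n y = B.pre n x)) = B.pre n x :=
      Exists.choose_spec (⟨x, rfl⟩ : ∃ y, B.pre n y = B.pre n x)
    have h3 := g.2.1.2 _ _ (fun j hj => congrFun h2 ⟨j, hj⟩) i hi
    have h4 := g'.2.1.2 _ _ (fun j hj => congrFun h2 ⟨j, hj⟩) i hi
    exact h3.symm.trans (Eq.trans h1 h4)
  · rw [g.2.1.1 x i hi, g'.2.1.1 x i hi]

instance countable_fullGroup : Countable ↥B.fullGroup := by
  have : (B.fullGroup : Set (Equiv.Perm B.Path)) = ⋃ n, (B.level n : Set _) := by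
    ext g
    simp only [Set.mem_iUnion]
    rfl
  have h : (B.fullGroup : Set (Equiv.Perm B.Path)).Countable := by
    rw [this]
    refine Set.countable_iUnion fun n => ?_
    exact Set.Finite.countable (B.finite_level n)
  exact h.to_subtype

/-- Replace the first `n` edges of `y` (which are those of `x`) by those of `z`. -/
def splice (n : ℕ) (x z : B.Path) (hxz : ∀ i, n ≤ i → x.1 i = z.1 i) (y : B.Path)
    (hy : ∀ i, i < n → y.1 i = x.1 i) : B.Path :=
  ⟨fun i => if i < n then z.1 i else y.1 i, by
    intro i
    rcases lt_trichotomy (i + 1) n with h | h | h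
    · simp only [h, show i < n by omega, if_true]
      exact z.2 i
    · have h1 : ¬ (i + 1 < n) := by omega
      have h2 : i < n := by omega
      simp only [h1, h2, if_true, if_false]
      rw [z.2 i, ← hxz (i + 1) (by omega), ← x.2 i, ← hy i h2, y.2 i]
    · have h1 : ¬ (i + 1 < n) := by omega
      have h2 : ¬ (i < n) := by omega
      simp only [h1, h2, if_false]
      exact y.2 i⟩

open Classical in
/-- Swap the prefixes of `x` and `z`. -/
def swapFun (n : ℕ) (x z : B.Path) (hxz : ∀ i, n ≤ i → x.1 i = z.1 i) (y : B.Path) : B.Path :=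
  if h : ∀ i, i < n → y.1 i = x.1 i then B.splice n x z hxz y h
  else if h' : ∀ i, i < n → y.1 i = z.1 i then
    B.splice n z x (fun i hi => (hxz i hi).symm) y h'
  else y

section
variable {B} {n : ℕ} {x z : B.Path}

theorem swapFun_tail (hxz : ∀ i, n ≤ i → x.1 i = z.1 i) (y : B.Path) (i : ℕ) (hi : n ≤ i) :
    (B.swapFun n x z hxz y).1 i = y.1 i := by
  unfold swapFun
  split_ifs <;> simp [splice, not_lt.mpr hi]

theorem swapFun_left (hxz : ∀ i, n ≤ i → x.1 i = z.1 i) (y : B.Path) (h : ∀ i, i < n → y.1 i = x.1 i) (i : ℕ) (hi : i < n) :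
    (B.swapFun n x z hxz y).1 i = z.1 i := by
  unfold swapFun
  rw [dif_pos h]
  simp [splice, hi]

theorem swapFun_right (hxz : ∀ i, n ≤ i → x.1 i = z.1 i) (y : B.Path) (h : ∀ i, i < n → y.1 i = z.1 i) (i : ℕ) (hi : i < n) :
    (B.swapFun n x z hxz y).1 i = x.1 i := by
  by_cases h' : ∀ i, i < n → y.1 i = x.1 i
  · rw [swapFun_left hxz y h' i hi, ← h i hi, h' i hi]
  · unfold swapFun
    rw [dif_neg h', dif_pos h]
    simp [splice, hi]

theorem swapFun_other (hxz : ∀ i, n ≤ i → x.1 i = z.1 i) (y : B.Path) (h : ¬ ∀ i, i < n → y.1 i = x.1 i)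
    (h' : ¬ ∀ i, i < n → y.1 i = z.1 i) :
    B.swapFun n x z hxz y = y := by
  unfold swapFun
  rw [dif_neg h, dif_neg h']

theorem swapFun_invol (hxz : ∀ i, n ≤ i → x.1 i = z.1 i) : Function.Involutive (B.swapFun n x z hxz) := by
  intro y
  by_cases h : ∀ i, i < n → y.1 i = x.1 i
  · apply Subtype.ext
    funext i
    rcases lt_or_ge i n with hi | hi
    · rw [swapFun_right hxz _ (swapFun_left hxz y h) i hi, h i hi]
    · rw [swapFun_tail hxz _ i hi, swapFun_tail hxz _ i hi]
  · by_cases h' : ∀ i, i < n → y.1 i = z.1 i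
    · apply Subtype.ext
      funext i
      rcases lt_or_ge i n with hi | hi
      · rw [swapFun_left hxz _ (swapFun_right hxz y h') i hi, h' i hi]
      · rw [swapFun_tail hxz _ i hi, swapFun_tail hxz _ i hi]
    · rw [swapFun_other hxz y h h', swapFun_other hxz y h h']

theorem swapFun_isLevel (hxz : ∀ i, n ≤ i → x.1 i = z.1 i) : B.IsLevel n (swapFun_invol hxz).toPerm := by
  refine ⟨fun y i hi => swapFun_tail hxz y i hi, ?_⟩
  intro y w hyw i hi
  change (B.swapFun n x z hxz y).1 i = (B.swapFun n x z hxz w).1 i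
  by_cases h : ∀ i, i < n → y.1 i = x.1 i
  · rw [swapFun_left hxz y h i hi,
      swapFun_left hxz w (fun j hj => (hyw j hj).symm.trans (h j hj)) i hi]
  · by_cases h' : ∀ i, i < n → y.1 i = z.1 i
    · rw [swapFun_right hxz y h' i hi,
        swapFun_right hxz w (fun j hj => (hyw j hj).symm.trans (h' j hj)) i hi]
    · rw [swapFun_other hxz y h h', swapFun_other hxz w, hyw i hi]
      · exact fun h2 => h fun j hj => (hyw j hj).trans (h2 j hj)
      · exact fun h2 => h' fun j hj => (hyw j hj).trans (h2 j hj)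

/-- The swap as an element of the full group. -/
theorem exists_swap (hxz : ∀ i, n ≤ i → x.1 i = z.1 i) : ∃ g : ↥B.fullGroup, g • x = z ∧
    ∀ y : B.Path, (¬ ∀ i, i < n → y.1 i = x.1 i) → (¬ ∀ i, i < n → y.1 i = z.1 i) →
      g • y = y := by
  refine ⟨⟨(swapFun_invol hxz).toPerm, n, swapFun_isLevel hxz, swapFun_isLevel hxz⟩, ?_, ?_⟩
  · change B.swapFun n x z hxz x = z
    apply Subtype.ext
    funext i
    rcases lt_or_ge i n with hi | hi
    · exact swapFun_left hxz x (fun _ _ => rfl) i hi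
    · rw [swapFun_tail hxz _ i hi, hxz i hi]
  · intro y h h'
    exact swapFun_other hxz y h h'

end

theorem exists_sep {ι : Type*} [Finite ι] (x : B.Path) (y : ι → B.Path) :
    ∃ N, ∀ i, y i ≠ x → ∀ n, N ≤ n → ¬ ∀ j, j < n → (y i).1 j = x.1 j := by
  have h : ∀ i, ∃ j, y i ≠ x → (y i).1 j ≠ x.1 j := by
    intro i
    by_cases hi : y i = x
    · exact ⟨0, fun h => absurd hi h⟩
    · by_contra hcon
      push Not at hcon
      exact hi (Subtype.ext (funext fun j => (hcon j).2))
  choose j hj using h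
  obtain ⟨M, hM⟩ := (Set.finite_range j).bddAbove
  refine ⟨M + 1, fun i hi n hn hcon => hj i hi (hcon _ ?_)⟩
  have := hM ⟨i, rfl⟩
  omega

theorem exists_close (heven : B.IsEven) (x : B.Path) (n : ℕ) :
    ∃ g : ↥B.fullGroup, g • x ≠ x ∧ ∀ i, i < n → (g • x).1 i = x.1 i := by
  obtain ⟨L, hL⟩ := heven n
  obtain ⟨hpos, hev⟩ := hL (B.src n (x.1 n)) (B.rng (n + L) (x.1 (n + L)))
  have h2 : 1 < B.numPaths n L (B.src n (x.1 n)) (B.rng (n + L) (x.1 (n + L))) := by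
    obtain ⟨r, hr⟩ := hev
    omega
  unfold numPaths at h2
  have hfin := Nat.finite_of_card_ne_zero (Nat.ne_of_gt (lt_trans Nat.one_pos h2))
  rw [Finite.one_lt_card_iff_nontrivial] at h2
  obtain ⟨⟨f, hf0, hfL⟩, hne⟩ := exists_ne (⟨⟨fun i => x.1 (n + i), fun i _ => x.2 (n + i)⟩,
    rfl, rfl⟩ : { f : B.Seg n L //
    B.src n (f.1 ⟨0, Nat.succ_pos L⟩) = B.src n (x.1 n) ∧
      B.rng (n + L) (f.1 ⟨L, Nat.lt_succ_self L⟩) = B.rng (n + L) (x.1 (n + L)) })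
  obtain ⟨y, hy1, hy2, hy3⟩ : ∃ y : ∀ i, B.E i, (∀ i, i < n → y i = x.1 i) ∧
      (∀ j (hj : j < L + 1), y (n + j) = f.1 ⟨j, hj⟩) ∧ ∀ i, n + L + 1 ≤ i → y i = x.1 i := by
    have hc : ∀ i, ∃ e : B.E i, (i < n → e = x.1 i) ∧
        (∀ j (hj : j < L + 1) (h : n + j = i), e = h ▸ f.1 ⟨j, hj⟩) ∧
        (n + L + 1 ≤ i → e = x.1 i) := by
      intro i
      by_cases h1 : i < n
      · exact ⟨x.1 i, fun _ => rfl, fun j hj h => by omega, fun _ => rfl⟩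
      · by_cases h2 : n + L + 1 ≤ i
        · exact ⟨x.1 i, fun _ => rfl, fun j hj h => by omega, fun _ => rfl⟩
        · obtain ⟨j, rfl⟩ := Nat.exists_eq_add_of_le (not_lt.mp h1)
          refine ⟨f.1 ⟨j, by omega⟩, fun h => absurd h h1, ?_, fun h => absurd h h2⟩
          intro j' hj' h
          obtain rfl : j' = j := by omega
          rfl
    choose y h1 h2 h3 using hc
    exact ⟨y, h1, fun j hj => h2 _ j hj rfl, h3⟩
  have hpath : ∀ i, B.rng i (y i) = B.src (i + 1) (y (i + 1)) := by
    intro i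
    rcases lt_trichotomy (i + 1) n with h | h | h
    · rw [hy1 i (by omega), hy1 (i + 1) h]
      exact x.2 i
    · subst h
      rw [hy1 i (by omega), x.2 i, ← hf0]
      exact congrArg _ (hy2 0 (by omega)).symm
    · obtain ⟨j, rfl⟩ := Nat.exists_eq_add_of_le (show n ≤ i by omega)
      rcases lt_trichotomy j L with hj | hj | hj
      · rw [hy2 j (by omega), f.2 j hj]
        exact congrArg _ (hy2 (j + 1) (by omega)).symm
      · subst hj
        rw [hy2 j (by omega), hfL, x.2, hy3 (n + j + 1) (by omega)]
      · rw [hy3 _ (by omega), hy3 _ (by omega)]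
        exact x.2 _
  obtain ⟨g, hg, -⟩ := exists_swap (B := B) (n := n + L + 1) (x := x) (z := ⟨y, hpath⟩)
    (fun i hi => (hy3 i hi).symm)
  refine ⟨g, ?_, ?_⟩
  · rw [hg]
    intro h
    apply hne
    apply Subtype.ext
    apply Subtype.ext
    funext j
    have := hy2 j j.2
    have h3 : y (n + j) = x.1 (n + j) := congrFun (congrArg Subtype.val h) (n + j)
    exact this.symm.trans h3
  · rw [hg]
    exact hy1

theorem orbit_infinite (heven : B.IsEven) (x : B.Path) :
    (MulAction.orbit ↥B.fullGroup x).Infinite := by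
  intro hfin
  have : Finite (MulAction.orbit ↥B.fullGroup x) := hfin
  obtain ⟨N, hN⟩ := B.exists_sep x (fun y : MulAction.orbit ↥B.fullGroup x => y.1)
  obtain ⟨g, hg, hg'⟩ := B.exists_close heven x N
  exact hN ⟨g • x, g, rfl⟩ hg N le_rfl hg'

theorem measurePreserving_smul {ν : Measure B.Path} (hinv : MeasInv ↥B.fullGroup ν)
    (g : ↥B.fullGroup) : MeasurePreserving (fun x : B.Path => g • x) ν ν := by
  refine ⟨B.measurable_smul g, ?_⟩
  ext s hs
  rw [Measure.map_apply (B.measurable_smul g) hs]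
  exact hinv g s hs

theorem measure_singleton (heven : B.IsEven) {ν : Measure B.Path} [IsProbabilityMeasure ν]
    (hinv : MeasInv ↥B.fullGroup ν) (x : B.Path) : ν {x} = 0 := by
  by_contra h
  have := (B.orbit_infinite heven x).meas_eq_top (μ := ν) ⟨ν {x}, h, ?_⟩
  · exact measure_ne_top ν _ this
  · rintro _ ⟨g, rfl⟩
    have h1 := hinv g {g • x} (measurableSet_singleton _)
    have h2 : (fun y : B.Path => g • y) ⁻¹' {g • x} = {x} := by
      ext y
      simp
    rw [h2] at h1
    exact h1.le

/-- Tuples with coordinates in pairwise distinct orbits. -/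
def genSet (ι : Type*) : Set (ι → B.Path) :=
  { y | ∀ p q, p ≠ q → ∀ g : ↥B.fullGroup, g • y p ≠ y q }

theorem measurableSet_eq_smul (g : ↥B.fullGroup) :
    MeasurableSet {z : B.Path × B.Path | g • z.1 = z.2} := by
  have : {z : B.Path × B.Path | g • z.1 = z.2} =
      ⋂ i, {z : B.Path × B.Path | (g • z.1).1 i = z.2.1 i} := by
    ext z
    simp only [Set.mem_ofPred_eq, Set.mem_iInter]
    exact ⟨fun h i => by rw [h], fun h => Subtype.ext (funext h)⟩
  rw [this]
  refine MeasurableSet.iInter fun i => ?_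
  let : MeasurableSpace (B.E i) := ⊤
  have hd : MeasurableSpace.CountablyGenerated (B.E i) := inferInstance
  have hc : Measurable (fun x : B.Path => x.1 i) := by
    have : BorelSpace (B.E i) := ⟨by rw [borel_eq_top_of_discrete]⟩
    exact (B.continuous_coord i).measurable
  exact measurableSet_eq_fun (hc.comp ((B.measurable_smul g).comp measurable_fst))
    (hc.comp measurable_snd)

theorem measurable_pair {ι : Type*} (p q : ι) :
    Measurable (fun y : ι → B.Path => (y p, y q)) :=
  (measurable_pi_apply p).prodMk (measurable_pi_apply q)

theorem measurableSet_genSet (ι : Type*) [Countable ι] : MeasurableSet (B.genSet ι) := by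
  have : B.genSet ι = ⋂ (p : ι) (q : ι) (_ : p ≠ q) (g : ↥B.fullGroup),
      {y : ι → B.Path | g • y p = y q}ᶜ := by
    ext y
    simp [genSet]
  rw [this]
  refine MeasurableSet.iInter fun p => MeasurableSet.iInter fun q => MeasurableSet.iInter fun _ =>
    MeasurableSet.iInter fun g => MeasurableSet.compl ?_
  exact measurableSet_preimage (B.measurable_pair p q)
    (B.measurableSet_eq_smul g)

theorem ae_genSet (heven : B.IsEven) {ι : Type*} [Fintype ι] (ν : ι → Measure B.Path)
    [∀ i, IsProbabilityMeasure (ν i)] (hinv : ∀ i, MeasInv ↥B.fullGroup (ν i)) :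
    ∀ᵐ y ∂(Measure.pi ν), y ∈ B.genSet ι := by
  simp only [genSet, Set.mem_ofPred_eq]
  rw [ae_all_iff]
  intro p
  rw [ae_all_iff]
  intro q
  rw [Filter.eventually_imp_distrib_left]
  intro hpq
  rw [ae_all_iff]
  intro g
  have hind := (ProbabilityTheory.iIndepFun_pi (μ := ν) (X := fun _ x => x)
    (fun _ => aemeasurable_id)).indepFun hpq
  rw [ProbabilityTheory.indepFun_iff_map_prod_eq_prod_map_map
    (measurable_pi_apply p).aemeasurable (measurable_pi_apply q).aemeasurable] at hind
  have hp := (measurePreserving_eval ν p).map_eq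
  have hq := (measurePreserving_eval ν q).map_eq
  change Measure.map (fun y : ι → B.Path => y p) _ = _ at hp
  change Measure.map (fun y : ι → B.Path => y q) _ = _ at hq
  rw [hp, hq] at hind
  have hnull : ((ν p).prod (ν q)) {z : B.Path × B.Path | g • z.1 = z.2} = 0 := by
    rw [Measure.measure_prod_null (B.measurableSet_eq_smul g)]
    refine Filter.Eventually.of_forall fun x => ?_
    have : Prod.mk x ⁻¹' {z : B.Path × B.Path | g • z.1 = z.2} = {g • x} := by
      ext y
      simp [eq_comm]
    simp only [this, Pi.zero_apply]
    exact B.measure_singleton heven (hinv q) _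
  rw [← hind, Measure.map_apply
    ((measurable_pi_apply p).prodMk (measurable_pi_apply q)) (B.measurableSet_eq_smul g)] at hnull
  rw [ae_iff]
  simpa using hnull

/-- On generic tuples, acting on a single coordinate stays in the diagonal orbit. -/
theorem exists_smul_eq_update {ι : Type*} [Finite ι] [DecidableEq ι] {y : ι → B.Path}
    (hy : y ∈ B.genSet ι) (p : ι) (g : ↥B.fullGroup) :
    ∃ h : ↥B.fullGroup, h • y = Function.update y p (g • y p) := by
  obtain ⟨m, hm⟩ := g.2
  obtain ⟨N₁, hN₁⟩ := B.exists_sep (y p) y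
  obtain ⟨N₂, hN₂⟩ := B.exists_sep (g • y p) y
  obtain ⟨h, hh1, hh2⟩ := exists_swap (B := B) (n := max m (max N₁ N₂)) (x := y p)
    (z := g • y p) (fun i hi => (hm.1.1 (y p) i (le_trans (le_max_left _ _) hi)).symm)
  refine ⟨h, ?_⟩
  funext q
  by_cases hq : q = p
  · subst hq
    simpa using hh1
  · rw [Function.update_of_ne hq, Pi.smul_apply]
    apply hh2
    · refine hN₁ q ?_ _ (by simp)
      have := hy q p hq 1
      simpa using this
    · exact hN₂ q (fun h => hy p q (Ne.symm hq) g h.symm) _ (by simp)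

theorem update_mem_genSet {ι : Type*} [DecidableEq ι] {y : ι → B.Path}
    (hy : y ∈ B.genSet ι) (p : ι) (g : ↥B.fullGroup) :
    Function.update y p (g • y p) ∈ B.genSet ι := by
  intro a b hab h
  by_cases ha : a = p
  · subst ha
    rw [Function.update_self, Function.update_of_ne (Ne.symm hab), smul_smul]
    exact hy _ _ hab _
  · rw [Function.update_of_ne ha]
    by_cases hb : b = p
    · subst hb
      rw [Function.update_self]
      intro h'
      apply hy _ _ hab (g⁻¹ * h)
      rw [mul_smul, h', inv_smul_smul]
    · rw [Function.update_of_ne hb]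
      exact hy _ _ hab _

end helpers

end BratteliDiagram

section prodErg

variable {G X : Type*} [Group G] [MeasurableSpace X] [MulAction G X]

theorem prodErg_fin (n : ℕ) (ν : Fin n → Measure X) [∀ i, IsProbabilityMeasure (ν i)]
    (herg : ∀ i, MeasErg G (ν i)) (A : Set (Fin n → X)) (hA : MeasurableSet A)
    (hinv : ∀ (p : Fin n) (g : G) (y : Fin n → X), y ∈ A → Function.update y p (g • y p) ∈ A) :
    Measure.pi ν A = 0 ∨ Measure.pi ν A = 1 := by
  induction n with
  | zero =>
    by_cases h : A = ∅
    · left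
      simp [h]
    · right
      obtain ⟨a, ha⟩ := Set.nonempty_iff_ne_empty.mpr h
      have : A = Set.univ := Set.eq_univ_of_forall fun b => by rwa [Subsingleton.elim b a]
      rw [this]
      exact measure_univ
  | succ n ih =>
    have hmp := (measurePreserving_piFinSuccAbove ν 0).symm
    rw [← hmp.measure_preimage_equiv A]
    set A' : Set (X × (Fin n → X)) :=
      (MeasurableEquiv.piFinSuccAbove (fun _ => X) 0).symm ⁻¹' A with hA'
    have hmem : ∀ x y, (x, y) ∈ A' ↔ (Fin.cons x y : Fin (n + 1) → X) ∈ A := by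
      intro x y
      rw [← Fin.insertNth_zero']
      rfl
    have hmeas : MeasurableSet A' := (MeasurableEquiv.measurable _) hA
    set ν' : Fin n → Measure X := fun j => ν ((0 : Fin (n + 1)).succAbove j) with hν'
    have hsec : ∀ x, Measure.pi ν' (Prod.mk x ⁻¹' A') = 0 ∨
        Measure.pi ν' (Prod.mk x ⁻¹' A') = 1 := by
      intro x
      refine ih ν' (fun i => herg _) _ (measurable_prodMk_left hmeas) ?_
      intro p g y hy
      rw [Set.mem_preimage, hmem] at hy ⊢
      have := hinv p.succ g _ hy
      rwa [Fin.cons_succ, ← Fin.cons_update] at this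
    set S : Set X := {x | Measure.pi ν' (Prod.mk x ⁻¹' A') = 1} with hS
    have hSm : MeasurableSet S :=
      (measurable_measure_prodMk_left hmeas) (measurableSet_singleton 1)
    have hsub : ∀ (g : G) x, Prod.mk x ⁻¹' A' ⊆ Prod.mk (g • x) ⁻¹' A' := by
      intro g x y hy
      rw [Set.mem_preimage, hmem] at hy ⊢
      have := hinv 0 g _ hy
      rwa [Fin.cons_zero, Fin.update_cons_zero] at this
    have hseq : ∀ (g : G) x, Prod.mk (g • x) ⁻¹' A' = Prod.mk x ⁻¹' A' := by
      intro g x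
      refine (Set.Subset.antisymm (hsub g x) ?_).symm
      have := hsub g⁻¹ (g • x)
      rwa [inv_smul_smul] at this
    have hSinv : ∀ g : G, (fun y => g • y) ⁻¹' S = S := by
      intro g
      ext x
      simp only [hS, Set.mem_preimage, Set.mem_ofPred_eq, hseq]
    have hval : ((ν 0).prod (Measure.pi ν')) A' = ν 0 S := by
      rw [Measure.prod_apply hmeas, ← lintegral_indicator_one hSm]
      congr 1
      funext x
      rcases hsec x with h | h
      · have : x ∉ S := by simp [hS, h]
        simp [this, h]
      · have : x ∈ S := h
        simp [this, h]
    have hfin := herg 0 S hSm hSinv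
    rw [← hval] at hfin
    exact hfin

theorem prodErg {ι : Type*} [Fintype ι] [DecidableEq ι] (ν : ι → Measure X)
    [∀ i, IsProbabilityMeasure (ν i)]
    (herg : ∀ i, MeasErg G (ν i)) (A : Set (ι → X)) (hA : MeasurableSet A)
    (hinv : ∀ (p : ι) (g : G) (y : ι → X), y ∈ A → Function.update y p (g • y p) ∈ A) :
    Measure.pi ν A = 0 ∨ Measure.pi ν A = 1 := by
  let e := (Fintype.equivFin ι).symm
  have hmp := measurePreserving_piCongrLeft ν e
  rw [← hmp.measure_preimage_equiv A]
  have hmem : ∀ z : Fin (Fintype.card ι) → X,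
      z ∈ (MeasurableEquiv.piCongrLeft (fun _ : ι => X) e) ⁻¹' A ↔ (z ∘ e.symm) ∈ A := by
    intro z
    have : (MeasurableEquiv.piCongrLeft (fun _ : ι => X) e) z = z ∘ e.symm := by
      funext i
      obtain ⟨j, rfl⟩ := e.surjective i
      simp only [MeasurableEquiv.coe_piCongrLeft, Equiv.piCongrLeft_apply_apply,
        Function.comp, Equiv.symm_apply_apply]
    rw [Set.mem_preimage, this]
  refine prodErg_fin (G := G) _ (fun i => ν (e i)) (fun i => herg _) _
    ((MeasurableEquiv.measurable _) hA) ?_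
  intro p g y hy
  rw [hmem] at hy ⊢
  have := hinv (e p) g _ hy
  rw [Function.comp_apply, Equiv.symm_apply_apply] at this
  rwa [Function.update_comp_equiv, Equiv.symm_symm]

end prodErg

theorem mem_conjSub {Γ : Type*} [Group Γ] (g a : Γ) (H : Subgroup Γ) :
    a ∈ conjSub g H ↔ g⁻¹ * a * g ∈ H := by
  unfold conjSub
  rw [Subgroup.mem_map]
  constructor
  · rintro ⟨x, hx, rfl⟩
    simpa [mul_assoc] using hx
  · intro h
    exact ⟨_, h, by simp [mul_assoc]⟩

theorem measurable_toSubgroup {Γ Y : Type*} [Group Γ] [MeasurableSpace Y] (f : Y → Subgroup Γ)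
    (h : ∀ a : Γ, MeasurableSet {y | a ∈ f y}) : Measurable f := by
  rw [measurable_comap_iff, measurable_set_iff]
  intro a
  exact measurableSet_setOfPred.mp (h a)

theorem measurableSet_mem_subgroup {Γ : Type*} [Group Γ] (a : Γ) :
    MeasurableSet {H : Subgroup Γ | a ∈ H} := by
  have h : Measurable (fun H : Subgroup Γ => (H : Set Γ)) := comap_measurable _
  exact measurableSet_setOfPred.mpr (measurable_set_iff.mp h a)

theorem measurable_conjSub {Γ : Type*} [Group Γ] (g : Γ) :
    Measurable (conjSub g : Subgroup Γ → Subgroup Γ) := by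
  apply measurable_toSubgroup
  intro a
  simp only [mem_conjSub]
  exact measurableSet_mem_subgroup _

theorem conjSub_stabilizer {Γ Y : Type*} [Group Γ] [MulAction Γ Y] (g : Γ) (y : Y) :
    conjSub g (MulAction.stabilizer Γ y) = MulAction.stabilizer Γ (g • y) := by
  ext a
  rw [mem_conjSub, MulAction.mem_stabilizer_iff, MulAction.mem_stabilizer_iff, mul_smul, mul_smul,
    inv_smul_eq_iff]

/-- for a simple (even) AF full group whose path space carries exactly `k`
ergodic invariant measures, every stabilizer distribution `φ_α` of the diagonal action on
`(X^{|α|}, μ_α)` is an ergodic invariant random subgroup. -/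
theorem stabDist_isErgodicIRS (B : BratteliDiagram)
    (hsimple : B.IsSimple) (heven : B.IsEven)
    (k : ℕ) (hk : 1 ≤ k) (μ : Fin k → Measure B.Path)
    (hprob : ∀ i, IsProbabilityMeasure (μ i))
    (hinv : ∀ i, MeasInv ↥B.fullGroup (μ i))
    (herg : ∀ i, MeasErg ↥B.fullGroup (μ i))
    (hdistinct : Function.Injective μ)
    (hcomplete : ∀ ν : Measure B.Path, IsProbabilityMeasure ν →
      MeasInv ↥B.fullGroup ν → MeasErg ↥B.fullGroup ν → ∃ i, ν = μ i)
    (α : Fin k → ℕ) :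
    IsErgodicIRS ↥B.fullGroup (B.stabDist μ α) := by
  classical
  have hprob' : ∀ p : Σ i : Fin k, Fin (α i), IsProbabilityMeasure (μ p.1) := fun p => hprob _
  have hP : IsProbabilityMeasure (B.prodMeasure μ α) := by
    unfold BratteliDiagram.prodMeasure
    infer_instance
  have hst : Measurable (fun y : (Σ i : Fin k, Fin (α i)) → B.Path =>
      MulAction.stabilizer ↥B.fullGroup y) := by
    apply measurable_toSubgroup
    intro a
    have : {y : (Σ i : Fin k, Fin (α i)) → B.Path | a ∈ MulAction.stabilizer ↥B.fullGroup y} =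
        ⋂ p, {y | a • y p = y p} := by
      ext y
      simp only [MulAction.mem_stabilizer_iff, Set.mem_ofPred_eq, Set.mem_iInter, funext_iff,
        Pi.smul_apply]
    rw [this]
    refine MeasurableSet.iInter fun p => ?_
    exact measurableSet_preimage (B.measurable_pair p p)
      (B.measurableSet_eq_smul a)
  refine ⟨⟨?_, ?_⟩, ?_⟩
  · exact Measure.isProbabilityMeasure_map hst.aemeasurable
  · intro g s hs
    unfold BratteliDiagram.stabDist
    rw [Measure.map_apply hst (measurable_conjSub g hs), Measure.map_apply hst hs]
    have hmp : MeasurePreserving (fun y : (Σ i : Fin k, Fin (α i)) → B.Path => g • y)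
        (B.prodMeasure μ α) (B.prodMeasure μ α) :=
      measurePreserving_pi _ _ fun p => B.measurePreserving_smul (hinv p.1) g
    rw [← hmp.measure_preimage (hst hs).nullMeasurableSet]
    congr 1
    ext y
    simp only [Set.mem_preimage, conjSub_stabilizer]
  · intro s hs hsinv
    unfold BratteliDiagram.stabDist
    rw [Measure.map_apply hst hs]
    set A := (fun y : (Σ i : Fin k, Fin (α i)) → B.Path =>
      MulAction.stabilizer ↥B.fullGroup y) ⁻¹' s with hA
    have hae : (A ∩ B.genSet (Σ i : Fin k, Fin (α i)) : Set _) =ᵐ[B.prodMeasure μ α] A := by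
      have := B.ae_genSet heven (fun p : Σ i : Fin k, Fin (α i) => μ p.1) (fun p => hinv p.1)
      change ∀ᵐ y ∂(B.prodMeasure μ α), _ at this
      filter_upwards [this] with y hy
      exact propext ⟨fun h => h.1, fun h => ⟨h, hy⟩⟩
    rw [← measure_congr hae]
    refine prodErg (G := ↥B.fullGroup) _ (fun p => herg p.1) _
      ((hst hs).inter (B.measurableSet_genSet _)) ?_
    rintro p g y ⟨hyA, hyD⟩
    refine ⟨?_, B.update_mem_genSet hyD p g⟩
    obtain ⟨h, hh⟩ := B.exists_smul_eq_update hyD p g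
    rw [← hh, Set.mem_preimage, ← conjSub_stabilizer, ← Set.mem_preimage, hsinv h]
    exact hyA
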